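/- Fix d ≥ 1 and Λ > 0, set d_L = (2L+1)^d − 1, and define κ^L : ℝ^d → ℂ by κ^L(x) = d_L^{-1} ∑_{n ∈ ℤ^d, 0<|n|_∞≤L} e^{iΛ n·x/L}, and κ_W : ℝ^d → ℝ by κ_W(x) = ∏_{j=1}^d sin(Λx_j)/(Λx_j) (with the value 1 when x_j = 0). Then for every multiindex α ∈ ℕ^d and every compact set K ⊂ ℝ^d, sup_{x ∈ K} |∂^α κ^L(x) − ∂^α κ_W(x)| → 0 as L → ∞. -/

import Mathlib

open Filter

/-- Partial derivative in the `j`-th coordinate direction. -/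
noncomputable def coordDeriv {d : ℕ} {E : Type*} [NormedAddCommGroup E] [NormedSpace ℝ E]
    (j : Fin d) (g : (Fin d → ℝ) → E) : (Fin d → ℝ) → E :=
  fun x => fderiv ℝ g x (Pi.single j 1)

/-- The multiindex partial derivative `∂^α = ∂^{α_1}_{x_1} ⋯ ∂^{α_d}_{x_d}`. -/
noncomputable def multiDeriv {d : ℕ} {E : Type*} [NormedAddCommGroup E] [NormedSpace ℝ E]
    (α : Fin d → ℕ) (g : (Fin d → ℝ) → E) : (Fin d → ℝ) → E :=
  (List.finRange d).foldr (fun j h => (coordDeriv j)^[α j] h) g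

open Topology

theorem coordDeriv_prod {d : ℕ} (F : Fin d → ℂ → ℂ) (hF : ∀ i, Differentiable ℂ (F i))
    (c b : ℂ) (j : Fin d) :
    coordDeriv j (fun x : Fin d → ℝ => c * ∏ i, F i (x i) + b) =
      fun x => c * ∏ i, (Function.update F j (deriv (F j))) i (x i) + 0 := by
  funext x
  have hd : ∀ i, Differentiable ℝ (fun x : Fin d → ℝ => F i (x i)) := fun i => by
    have h1 : Differentiable ℝ (F i) := (hF i).restrictScalars ℝ
    have h2 : Differentiable ℝ (fun x : Fin d → ℝ => ((x i : ℝ) : ℂ)) :=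
      Complex.ofRealCLM.differentiable.comp (differentiable_apply i)
    exact h1.comp h2
  have hD : DifferentiableAt ℝ (fun x : Fin d → ℝ => c * ∏ i, F i (x i) + b) x := by
    refine DifferentiableAt.add_const _ (DifferentiableAt.const_mul ?_ c)
    exact (HasFDerivAt.finsetProd (u := Finset.univ)
      (fun i _ => (hd i x).hasFDerivAt)).differentiableAt
  have key : HasDerivAt (fun t : ℝ => c * ∏ i, F i (((x + t • Pi.single j (1:ℝ) : Fin d → ℝ) i : ℝ) : ℂ) + b)
      (c * ∏ i, (Function.update F j (deriv (F j))) i (x i)) 0 := by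
    have e : (fun t : ℝ => c * ∏ i, F i (((x + t • Pi.single j (1:ℝ) : Fin d → ℝ) i : ℝ) : ℂ) + b) =
        fun t : ℝ => c * (F j ((x j : ℂ) + (t:ℂ)) * ∏ i ∈ Finset.univ.erase j, F i (x i)) + b := by
      funext t
      rw [← Finset.mul_prod_erase Finset.univ _ (Finset.mem_univ j)]
      congr 3
      · simp
      · refine Finset.prod_congr rfl fun i hi => ?_
        simp [Pi.single_apply, Finset.ne_of_mem_erase hi]
    rw [e, ← Finset.mul_prod_erase Finset.univ _ (Finset.mem_univ j)]
    have e2 : ∏ i ∈ Finset.univ.erase j, (Function.update F j (deriv (F j))) i (x i) =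
        ∏ i ∈ Finset.univ.erase j, F i (x i) :=
      Finset.prod_congr rfl fun i hi => by
        rw [Function.update_of_ne (Finset.ne_of_mem_erase hi)]
    rw [e2, Function.update_self]
    refine (HasDerivAt.const_mul c (HasDerivAt.mul_const ?_ _)).add_const b
    have h0 : HasDerivAt (fun z : ℂ => F j ((x j : ℂ) + z)) (deriv (F j) (x j)) ((0:ℝ):ℂ) := by
      have : HasDerivAt (F j) (deriv (F j) (x j)) ((x j : ℂ) + ((0:ℝ):ℂ)) := by
        simpa using (hF j (x j)).hasDerivAt
      exact this.comp_const_add _ _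
    exact h0.comp_ofReal
  have := hD.lineDeriv_eq_fderiv (v := Pi.single j (1:ℝ))
  simp only [coordDeriv, add_zero]
  rw [← this]
  exact key.deriv

theorem diff_iter (f : ℂ → ℂ) (hf : Differentiable ℂ f) (k : ℕ) : Differentiable ℂ (deriv^[k] f) := by
  have := (hf.contDiff (n := ⊤)).differentiable_iteratedDeriv k (by exact_mod_cast WithTop.coe_lt_top _)
  rwa [iteratedDeriv_eq_iterate] at this

theorem coordDeriv_iter {d : ℕ} (F : Fin d → ℂ → ℂ) (hF : ∀ i, Differentiable ℂ (F i))
    (c b : ℂ) (j : Fin d) (k : ℕ) (m : Fin d → ℕ) : ∃ b' : ℂ, ‖b'‖ ≤ ‖b‖ ∧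
    (coordDeriv j)^[k] (fun x : Fin d → ℝ => c * ∏ i, (deriv^[m i] (F i)) (x i) + b) =
      fun x => c * ∏ i, (deriv^[m i + if i = j then k else 0] (F i)) (x i) + b' := by
  induction k with
  | zero => exact ⟨b, le_rfl, by simp⟩
  | succ k ih =>
    obtain ⟨b', hb, h⟩ := ih
    refine ⟨0, by simp, ?_⟩
    rw [Function.iterate_succ_apply', h,
      coordDeriv_prod (fun i => deriv^[m i + if i = j then k else 0] (F i)) (fun i => diff_iter _ (hF i) _)]
    funext x
    congr 2
    refine Finset.prod_congr rfl fun i _ => ?_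
    by_cases hi : i = j
    · subst hi
      simp only [Function.update_self, if_true]
      rw [← Function.iterate_succ_apply' deriv]
      rfl
    · simp [Function.update_of_ne hi, hi]

theorem multiDeriv_prod {d : ℕ} (F : Fin d → ℂ → ℂ) (hF : ∀ i, Differentiable ℂ (F i))
    (c b : ℂ) (α : Fin d → ℕ) : ∃ b' : ℂ, ‖b'‖ ≤ ‖b‖ ∧
    multiDeriv α (fun x : Fin d → ℝ => c * ∏ i, (F i) (x i) + b) =
      fun x => c * ∏ i, (deriv^[α i] (F i)) (x i) + b' := by
  have gen : ∀ l : List (Fin d), ∃ b' : ℂ, ‖b'‖ ≤ ‖b‖ ∧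
      l.foldr (fun j h => (coordDeriv j)^[α j] h) (fun x : Fin d → ℝ => c * ∏ i, (F i) (x i) + b) =
      fun x => c * ∏ i, (deriv^[l.count i * α i] (F i)) (x i) + b' := by
    intro l
    induction l with
    | nil => exact ⟨b, le_rfl, by simp⟩
    | cons j l ih =>
      obtain ⟨b', hb, h⟩ := ih
      obtain ⟨b'', hb', h'⟩ := coordDeriv_iter F hF c b' j (α j) (fun i => l.count i * α i)
      refine ⟨b'', hb'.trans hb, ?_⟩
      rw [List.foldr_cons, h, h']
      funext x
      congr 2
      refine Finset.prod_congr rfl fun i _ => ?_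
      congr 2
      by_cases hi : i = j
      · subst hi; simp [add_mul]
      · simp [hi, List.count_cons_of_ne (Ne.symm hi)]
  obtain ⟨b', hb, h⟩ := gen (List.finRange d)
  refine ⟨b', hb, ?_⟩
  rw [multiDeriv, h]
  simp [List.count_eq_one_of_mem (List.nodup_finRange d) (List.mem_finRange _)]

noncomputable def fLat (Λ : ℝ) (L : ℕ) (z : ℂ) : ℂ :=
  (2 * (L:ℂ) + 1)⁻¹ * ∑ n ∈ Finset.Icc (-(L : ℤ)) (L : ℤ), Complex.exp (Complex.I * Λ * z * ((n / L : ℝ) : ℂ))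

noncomputable def gLim (Λ : ℝ) (z : ℂ) : ℂ :=
  (1/2) * ∫ u in (-1:ℝ)..1, Complex.exp (Complex.I * Λ * z * (u:ℂ))

theorem fLat_diff (Λ : ℝ) (L : ℕ) : Differentiable ℂ (fLat Λ L) := by
  unfold fLat
  fun_prop

theorem gLim_real (Λ : ℝ) (hΛ : 0 < Λ) (x : ℝ) :
    gLim Λ x = ((if x = 0 then (1 : ℝ) else Real.sin (Λ * x) / (Λ * x) : ℝ) : ℂ) := by
  unfold gLim
  split_ifs with h
  · simp [h]; norm_num
  · have hc : Complex.I * Λ * x ≠ 0 := by simp [h, hΛ.ne']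
    rw [integral_exp_mul_complex hc]
    push_cast
    rw [Complex.sin]
    have h1 : (Λ:ℂ) ≠ 0 := by exact_mod_cast hΛ.ne'
    have h2 : (x:ℂ) ≠ 0 := by exact_mod_cast h
    have e1 : Complex.I * Λ * x * 1 = Λ * x * Complex.I := by ring
    have e2 : Complex.I * Λ * x * (-1) = -(Λ * x) * Complex.I := by ring
    rw [e1, e2]
    field_simp
    rw [Complex.I_sq]; ring

theorem exp_lip (w : ℂ) (a b : ℝ) (ha : |a| ≤ 1) (hb : |b| ≤ 1) :
    ‖Complex.exp (w * (a:ℂ)) - Complex.exp (w * (b:ℂ))‖ ≤ ‖w‖ * Real.exp ‖w‖ * |a - b| := by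
  have := (convex_Icc (-1:ℝ) 1).norm_image_sub_le_of_norm_hasDerivWithin_le
    (f := fun t : ℝ => Complex.exp (w * (t:ℂ))) (f' := fun t : ℝ => Complex.exp (w * (t:ℂ)) * w)
    (C := ‖w‖ * Real.exp ‖w‖) (x := b) (y := a) ?_ ?_ (abs_le.1 hb) (abs_le.1 ha)
  · simpa using this
  · intro t _
    have : HasDerivAt (fun z : ℂ => Complex.exp (w * z)) (Complex.exp (w * (t:ℂ)) * w) (t:ℂ) := by
      simpa using ((hasDerivAt_id (t:ℂ)).const_mul w).cexp
    exact this.comp_ofReal.hasDerivWithinAt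
  · intro t ht
    rw [norm_mul, mul_comm, Complex.norm_exp]
    gcongr
    refine (Complex.re_le_norm _).trans ?_
    rw [norm_mul, Complex.norm_real]
    exact mul_le_of_le_one_right (norm_nonneg _) (abs_le.2 ht)

theorem fLat_close (Λ : ℝ) (L : ℕ) (hL : 1 ≤ L) (z : ℂ) :
    ‖gLim Λ z - fLat Λ L z‖ ≤
      ‖Complex.I * Λ * z‖ * Real.exp ‖Complex.I * Λ * z‖ * (2 / (2 * L + 1)) := by
  set w := Complex.I * Λ * z with hw
  set C := ‖w‖ * Real.exp ‖w‖
  have hL' : (1:ℝ) ≤ L := by exact_mod_cast hL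
  set N : ℝ := 2 * L + 1 with hN
  have hN0 : 0 < N := by positivity
  let a : ℕ → ℝ := fun k => -1 + 2 * k / N
  have hsum : ∑ n ∈ Finset.Icc (-(L : ℤ)) (L : ℤ), Complex.exp (w * ((n / L : ℝ) : ℂ)) =
      ∑ k ∈ Finset.range (2 * L + 1), Complex.exp (w * ((((k:ℝ) - L) / L : ℝ) : ℂ)) := by
    symm
    refine Finset.sum_bij (fun k _ => (k:ℤ) - L) ?_ ?_ ?_ ?_
    · intro k hk; simp at hk ⊢; omega
    · intro k _ l _ h; simpa using h
    · intro n hn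
      simp at hn
      exact ⟨(n + L).toNat, by simp; omega, by simp; omega⟩
    · intro k _; push_cast; rfl
  have hIntble : ∀ x y : ℝ, IntervalIntegrable (fun u : ℝ => Complex.exp (w * (u:ℂ))) MeasureTheory.volume x y :=
    fun x y => Continuous.intervalIntegrable (by fun_prop) _ _
  have hI : ∫ u in (-1:ℝ)..1, Complex.exp (w * (u:ℂ)) =
      ∑ k ∈ Finset.range (2 * L + 1), ∫ u in (a k)..(a (k+1)), Complex.exp (w * (u:ℂ)) := by
    rw [intervalIntegral.sum_integral_adjacent_intervals (fun k _ => hIntble _ _)]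
    congr 1
    · simp [a]
    · simp only [a]; push_cast; rw [← hN]; field_simp; norm_num
  have hw2 : ∀ k, a (k+1) - a k = 2 / N := fun k => by simp only [a]; push_cast; ring
  have hf : fLat Λ L z = (1/2) * ∑ k ∈ Finset.range (2 * L + 1),
      ∫ u in (a k)..(a (k+1)), Complex.exp (w * ((((k:ℝ) - L) / L : ℝ) : ℂ)) := by
    unfold fLat
    rw [← hw, hsum]
    simp only [intervalIntegral.integral_const, hw2]
    rw [← Finset.smul_sum, Complex.real_smul, ← mul_assoc]
    congr 1
    rw [hN]; push_cast; field_simp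
  rw [hf, gLim, ← hw, hI, ← mul_sub, ← Finset.sum_sub_distrib]
  have hb : ∀ k ∈ Finset.range (2 * L + 1), ‖(∫ u in (a k)..(a (k+1)), Complex.exp (w * (u:ℂ))) -
      ∫ u in (a k)..(a (k+1)), Complex.exp (w * ((((k:ℝ) - L) / L : ℝ) : ℂ))‖ ≤
      C * (2 / N) * (2 / N) := by
    intro k hk
    have hk' : (k:ℝ) ≤ 2 * L := by
      have := Finset.mem_range.1 hk
      exact_mod_cast Nat.lt_succ_iff.1 this
    have hk0 : (0:ℝ) ≤ k := Nat.cast_nonneg k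
    rw [← intervalIntegral.integral_sub (hIntble _ _) (by simp)]
    have hle : a k ≤ a (k+1) := by
      have := hw2 k
      have : 0 < 2 / N := by positivity
      linarith
    refine (intervalIntegral.norm_integral_le_of_norm_le_const (C := C * (2/N)) ?_).trans ?_
    · intro u hu
      rw [Set.uIoc_of_le hle] at hu
      obtain ⟨h1, h2⟩ := hu
      have A0 : -1 ≤ a k := by
        simp only [a]
        have : 0 ≤ 2 * k / N := by positivity
        linarith
      have A1 : a (k+1) ≤ 1 := by
        simp only [a]; push_cast
        have : 2 * ((k:ℝ)+1) / N ≤ 2 := by rw [div_le_iff₀ hN0]; linarith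
        linarith
      have B0 : a k ≤ ((k:ℝ) - L) / L := by
        simp only [a]
        have : ((k:ℝ) - L) / L - (-1 + 2 * k / N) = k / (L * N) := by
          rw [hN]; field_simp; ring
        have : 0 ≤ k / (L * N) := by positivity
        linarith
      have B1 : ((k:ℝ) - L) / L ≤ a (k+1) := by
        simp only [a]; push_cast
        have : (-1 + 2 * ((k:ℝ)+1) / N) - ((k:ℝ) - L) / L = (2 * L - k) / (L * N) := by
          rw [hN]; field_simp; ring
        have : 0 ≤ (2 * L - k) / (L * N) := div_nonneg (by linarith) (by positivity)
        linarith
      refine (exp_lip w u _ ?_ ?_).trans ?_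
      · rw [abs_le]; constructor <;> linarith
      · rw [abs_le]; constructor <;> linarith
      · have := hw2 k
        gcongr
        rw [abs_le]; constructor <;> linarith
    · rw [hw2, abs_of_pos (by positivity)]
  rw [norm_mul]
  have := norm_sum_le_of_le _ hb
  rw [Finset.sum_const, Finset.card_range, nsmul_eq_mul] at this
  have e : ‖(1/2:ℂ)‖ = 1/2 := by simp
  rw [e]
  have e3 : (((2 * L + 1 : ℕ) : ℝ)) = N := by rw [hN]; push_cast; rfl
  rw [e3] at this
  have e4 : N * (C * (2 / N) * (2 / N)) = 2 * (C * (2/N)) := by field_simp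
  linarith

theorem fLat_tendsto (Λ : ℝ) :
    TendstoLocallyUniformlyOn (fun L => fLat Λ L) (gLim Λ) atTop Set.univ := by
  rw [tendstoLocallyUniformlyOn_iff_forall_isCompact isOpen_univ]
  intro K _ hK
  obtain ⟨R, hR⟩ := hK.isBounded.exists_norm_le
  set M := ‖Complex.I * Λ‖ * |R| with hM
  have ht : Tendsto (fun L : ℕ => M * Real.exp M * (2 / (2 * (L:ℝ) + 1))) atTop (𝓝 0) := by
    rw [← mul_zero (M * Real.exp M)]
    refine Tendsto.const_mul _ (Tendsto.const_div_atTop ?_ _)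
    exact tendsto_atTop_add_const_right _ _
      (Tendsto.const_mul_atTop two_pos tendsto_natCast_atTop_atTop)
  rw [Metric.tendstoUniformlyOn_iff]
  intro ε hε
  filter_upwards [ht.eventually_lt_const hε, eventually_ge_atTop 1] with L h1 h2 z hz
  rw [dist_eq_norm]
  refine (fLat_close Λ L h2 z).trans_lt (lt_of_le_of_lt ?_ h1)
  have : ‖Complex.I * Λ * z‖ ≤ M := by
    rw [norm_mul, hM]; gcongr; exact (hR z hz).trans (le_abs_self R)
  gcongr

theorem iter_tendsto (Λ : ℝ) (k : ℕ) :
    TendstoLocallyUniformlyOn (fun L => deriv^[k] (fLat Λ L)) (deriv^[k] (gLim Λ)) atTop Set.univ := by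
  induction k with
  | zero => exact fLat_tendsto Λ
  | succ k ih =>
    simp only [Function.iterate_succ_apply']
    refine ih.deriv (Eventually.of_forall fun L => ?_) isOpen_univ
    have := ((fLat_diff Λ L).contDiff (n := ⊤)).differentiable_iteratedDeriv k
      (by exact_mod_cast WithTop.coe_lt_top _)
    rw [iteratedDeriv_eq_iterate] at this
    exact this.differentiableOn

theorem gLim_diff (Λ : ℝ) : Differentiable ℂ (gLim Λ) :=
  differentiableOn_univ.1 ((fLat_tendsto Λ).differentiableOn
    (Eventually.of_forall fun L => (fLat_diff Λ L).differentiableOn) isOpen_univ)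
theorem kappa_eq (d : ℕ) (Λ : ℝ) (L : ℕ) (x : Fin d → ℝ) :
        ((((2 * L + 1) ^ d - 1 : ℕ) : ℂ))⁻¹ *
          ∑ n ∈ (Finset.Icc (fun _ : Fin d => -(L : ℤ)) (fun _ : Fin d => (L : ℤ))).erase 0,
            Complex.exp (Complex.I * ((Λ * ∑ j, (n j : ℝ) * x j) / (L : ℝ) : ℝ)) =
      (((((2 * L + 1) ^ d - 1 : ℕ) : ℂ))⁻¹ * (2 * (L:ℂ) + 1) ^ d) * ∏ i, fLat Λ L (x i) +
        -((((2 * L + 1) ^ d - 1 : ℕ) : ℂ))⁻¹ := by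
  have hN : (2 * (L:ℂ) + 1) ≠ 0 := by exact_mod_cast (Nat.succ_ne_zero (2 * L))
  have h0 : (0 : Fin d → ℤ) ∈ Finset.Icc (fun _ : Fin d => -(L : ℤ)) (fun _ : Fin d => (L : ℤ)) := by
    rw [Finset.mem_Icc]; constructor <;> intro i <;> simp
  have hIcc : Finset.Icc (fun _ : Fin d => -(L : ℤ)) (fun _ : Fin d => (L : ℤ)) =
      Fintype.piFinset fun _ => Finset.Icc (-(L : ℤ)) (L : ℤ) := by
    ext n; simp [Pi.le_def, forall_and]
  rw [Finset.sum_erase_eq_sub h0, hIcc]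
  have hs : ∑ n ∈ Fintype.piFinset fun _ : Fin d => Finset.Icc (-(L : ℤ)) (L : ℤ),
      Complex.exp (Complex.I * ((Λ * ∑ j, (n j : ℝ) * x j) / (L : ℝ) : ℝ)) =
      (2 * (L:ℂ) + 1) ^ d * ∏ i, fLat Λ L (x i) := by
    unfold fLat
    rw [Finset.prod_mul_distrib, Finset.prod_const, Finset.card_univ, Fintype.card_fin, ← mul_assoc,
      ← mul_pow, mul_inv_cancel₀ hN, one_pow, one_mul, Finset.prod_univ_sum]
    refine Finset.sum_congr rfl fun n _ => ?_
    rw [← Complex.exp_sum]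
    congr 1
    push_cast
    rw [Finset.mul_sum, Finset.sum_div, Finset.mul_sum]
    refine Finset.sum_congr rfl fun j _ => ?_
    ring
  rw [hs]
  simp
  ring

theorem c_tendsto (d : ℕ) (hd : 1 ≤ d) :
    Tendsto (fun L : ℕ => ((((2 * L + 1) ^ d - 1 : ℕ) : ℂ))⁻¹) atTop (𝓝 0) := by
  refine (tendsto_inv₀_cobounded (α := ℂ)).comp ?_
  rw [← tendsto_norm_atTop_iff_cobounded]
  simp only [Complex.norm_natCast]
  refine tendsto_natCast_atTop_atTop.comp (tendsto_atTop_mono (fun L => ?_) tendsto_id)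
  have : (2 * L + 1) ^ 1 ≤ (2 * L + 1) ^ d := Nat.pow_le_pow_right (by omega) hd
  rw [pow_one] at this
  generalize (2 * L + 1) ^ d = P at this ⊢
  simp only [id]
  omega

theorem A_tendsto (d : ℕ) (hd : 1 ≤ d) :
    Tendsto (fun L : ℕ => ((((2 * L + 1) ^ d - 1 : ℕ) : ℂ))⁻¹ * (2 * (L:ℂ) + 1) ^ d) atTop (𝓝 1) := by
  have h : Tendsto (fun L : ℕ => 1 + ((((2 * L + 1) ^ d - 1 : ℕ) : ℂ))⁻¹) atTop (𝓝 1) := by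
    simpa using (c_tendsto d hd).const_add 1
  refine h.congr' ?_
  filter_upwards [eventually_ge_atTop 1] with L hL
  have h1 : (2 * L + 1) ^ 1 ≤ (2 * L + 1) ^ d := Nat.pow_le_pow_right (by omega) hd
  rw [pow_one] at h1
  have hne : ((((2 * L + 1) ^ d - 1 : ℕ) : ℂ)) ≠ 0 := by
    rw [Nat.cast_ne_zero]; generalize (2 * L + 1) ^ d = P at h1 ⊢; omega
  have e : (2 * (L:ℂ) + 1) ^ d = (((2 * L + 1) ^ d - 1 : ℕ) : ℂ) + 1 := by
    rw [Nat.cast_sub (le_trans (by omega) h1)]; push_cast; ring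
  rw [e]
  field_simp

/-- With `d_L = (2L+1)^d − 1`,
`κ^L(x) = d_L^{-1} ∑_{0<|n|_∞≤L} e^{iΛ n·x/L}` and
`κ_W(x) = ∏_j sin(Λx_j)/(Λx_j)` (value 1 when `x_j = 0`), for every multiindex `α ∈ ℕ^d` and
every compact `K ⊂ ℝ^d` one has `sup_{x ∈ K} |∂^α κ^L(x) − ∂^α κ_W(x)| → 0` as `L → ∞`. -/
theorem stmt11 (d : ℕ) (hd : 1 ≤ d) (Λ : ℝ) (hΛ : 0 < Λ)
    (α : Fin d → ℕ) (K : Set (Fin d → ℝ)) (hK : IsCompact K) :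
    TendstoUniformlyOn
      (fun L : ℕ => multiDeriv α (fun x : Fin d → ℝ =>
        ((((2 * L + 1) ^ d - 1 : ℕ) : ℂ))⁻¹ *
          ∑ n ∈ (Finset.Icc (fun _ : Fin d => -(L : ℤ)) (fun _ : Fin d => (L : ℤ))).erase 0,
            Complex.exp (Complex.I * ((Λ * ∑ j, (n j : ℝ) * x j) / (L : ℝ) : ℝ))))
      (multiDeriv α (fun x : Fin d → ℝ =>
        ((∏ j, if x j = 0 then (1 : ℝ) else Real.sin (Λ * x j) / (Λ * x j) : ℝ) : ℂ)))
      atTop K := by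
  have hW : (fun x : Fin d → ℝ =>
        ((∏ j, if x j = 0 then (1 : ℝ) else Real.sin (Λ * x j) / (Λ * x j) : ℝ) : ℂ)) =
      fun x => 1 * ∏ i, gLim Λ (x i) + 0 := by
    funext x
    rw [Complex.ofReal_prod, one_mul, add_zero]
    exact Finset.prod_congr rfl fun i _ => (gLim_real Λ hΛ (x i)).symm
  rw [hW]
  simp only [kappa_eq]
  obtain ⟨b0, hb0, h0⟩ := multiDeriv_prod (fun _ => gLim Λ) (fun _ => gLim_diff Λ) 1 0 α
  have hb0' : b0 = 0 := by simpa using hb0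
  subst hb0'
  rw [h0]
  choose b hb h using fun L : ℕ => multiDeriv_prod (fun _ => fLat Λ L) (fun _ => fLat_diff Λ L)
    (((((2 * L + 1) ^ d - 1 : ℕ) : ℂ))⁻¹ * (2 * (L:ℂ) + 1) ^ d)
    (-((((2 * L + 1) ^ d - 1 : ℕ) : ℂ))⁻¹) α
  simp only [h]
  have hbt : Tendsto b atTop (𝓝 0) := by
    refine squeeze_zero_norm hb ?_
    simpa only [norm_neg, norm_zero] using (c_tendsto d hd).norm
  rw [← tendstoLocallyUniformlyOn_iff_tendstoUniformlyOn_of_compact hK]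
  refine TendstoLocallyUniformlyOn.mono (s := Set.univ) ?_ (Set.subset_univ _)
  rw [isOpen_univ.tendstoLocallyUniformlyOn_iff_forall_tendsto]
  intro x _
  have hcont : ∀ i, Tendsto (fun y : ℕ × (Fin d → ℝ) => ((y.2 i : ℝ) : ℂ)) (atTop ×ˢ 𝓝 x) (𝓝 (x i : ℂ)) :=
    fun i => Tendsto.comp (g := fun x : Fin d → ℝ => ((x i : ℝ) : ℂ))
      (Continuous.tendsto (by fun_prop) x) tendsto_snd
  have hg : ∀ i, Tendsto (fun y : ℕ × (Fin d → ℝ) => (deriv^[α i] (gLim Λ)) (y.2 i))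
      (atTop ×ˢ 𝓝 x) (𝓝 ((deriv^[α i] (gLim Λ)) (x i))) := fun i =>
    ((diff_iter _ (gLim_diff Λ) (α i)).continuous.tendsto _).comp (hcont i)
  have hf : ∀ i, Tendsto (fun y : ℕ × (Fin d → ℝ) => (deriv^[α i] (fLat Λ y.1)) (y.2 i))
      (atTop ×ˢ 𝓝 x) (𝓝 ((deriv^[α i] (gLim Λ)) (x i))) := fun i => by
    have h1 := isOpen_univ.tendstoLocallyUniformlyOn_iff_forall_tendsto.1
      (iter_tendsto Λ (α i)) (x i : ℂ) (Set.mem_univ _)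
    have h2 : Tendsto (fun y : ℕ × (Fin d → ℝ) => (y.1, ((y.2 i : ℝ) : ℂ))) (atTop ×ˢ 𝓝 x)
      (atTop ×ˢ 𝓝 (x i : ℂ)) := tendsto_fst.prodMk (hcont i)
    exact (hg i).congr_uniformity (h1.comp h2)
  have hG := ((tendsto_finsetProd Finset.univ fun i _ => hg i).const_mul (1:ℂ)).add_const 0
  have hF := (((A_tendsto d hd).comp tendsto_fst).mul
    (tendsto_finsetProd Finset.univ fun i _ => hf i)).add (hbt.comp tendsto_fst)
  refine Tendsto.mono_right ?_ (nhds_le_uniformity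
    (1 * ∏ i, (deriv^[α i] (gLim Λ)) (x i) + 0))
  rw [nhds_prod_eq]
  exact hG.prodMk hF
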